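/- Let p, q be nonzero real numbers and s > 0. The trace function Φ_{p,q,s}(A,B) = Tr[(A^{q/2} B^p A^{q/2})^s] is jointly concave on pairs of n×n positive definite complex matrices for all n if and only if 0 < p ≤ 1, 0 < q ≤ 1, and 0 < s ≤ 1/(p+q). -/

import Mathlib

open Matrix
open scoped ComplexOrder

/-- Real power of a matrix, defined via the spectral decomposition when the matrix is
Hermitian (junk value `0` otherwise). For a positive (semi-)definite matrix this is the
usual real power given by the spectral functional calculus (with `0 ^ r = 0`). -/
noncomputable def mpow {n : ℕ} (A : Matrix (Fin n) (Fin n) ℂ) (r : ℝ) :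
    Matrix (Fin n) (Fin n) ℂ :=
  if h : A.IsHermitian then
    (h.eigenvectorUnitary : Matrix (Fin n) (Fin n) ℂ) *
      Matrix.diagonal (fun i => ((h.eigenvalues i ^ r : ℝ) : ℂ)) *
      (star h.eigenvectorUnitary : Matrix (Fin n) (Fin n) ℂ)
  else 0

/-- `Ψ_{K,p,q,s}(A,B) = Tr[(A^{q/2} K* B^p K A^{q/2})^s]`. -/
noncomputable def Psi {n : ℕ} (K : Matrix (Fin n) (Fin n) ℂ) (p q s : ℝ)
    (A B : Matrix (Fin n) (Fin n) ℂ) : ℝ :=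
  (Matrix.trace (mpow (mpow A (q / 2) * Kᴴ * mpow B p * K * mpow A (q / 2)) s)).re

/-- `Φ_{p,q,s}(A,B) = Tr[(A^{q/2} B^p A^{q/2})^s]`. -/
noncomputable def Phi {n : ℕ} (p q s : ℝ) (A B : Matrix (Fin n) (Fin n) ℂ) : ℝ :=
  (Matrix.trace (mpow (mpow A (q / 2) * mpow B p * mpow A (q / 2)) s)).re

/-- Joint concavity of a real-valued function of two positive definite matrices. -/
def JointlyConcave {n : ℕ}
    (f : Matrix (Fin n) (Fin n) ℂ → Matrix (Fin n) (Fin n) ℂ → ℝ) : Prop :=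
  ∀ A₁ A₂ B₁ B₂ : Matrix (Fin n) (Fin n) ℂ,
    A₁.PosDef → A₂.PosDef → B₁.PosDef → B₂.PosDef →
    ∀ t : ℝ, 0 ≤ t → t ≤ 1 →
      t * f A₁ B₁ + (1 - t) * f A₂ B₂ ≤
        f (t • A₁ + (1 - t) • A₂) (t • B₁ + (1 - t) • B₂)

section SpectralCalculus

variable {n : ℕ}

/-- The real part of the trace. -/
noncomputable def reTr (A : Matrix (Fin n) (Fin n) ℂ) : ℝ := (Matrix.trace A).re

lemma reTr_add (A B : Matrix (Fin n) (Fin n) ℂ) : reTr (A + B) = reTr A + reTr B := by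
  simp [reTr]

lemma reTr_sub (A B : Matrix (Fin n) (Fin n) ℂ) : reTr (A - B) = reTr A - reTr B := by
  simp [reTr]

lemma reTr_smul (t : ℝ) (A : Matrix (Fin n) (Fin n) ℂ) : reTr (t • A) = t * reTr A := by
  simp [reTr]

lemma reTr_mul_comm (A B : Matrix (Fin n) (Fin n) ℂ) : reTr (A * B) = reTr (B * A) := by
  simp [reTr, Matrix.trace_mul_comm A B]

/-- The matrix with eigenvalues `d` in the orthonormal basis given by the columns of `U`. -/
noncomputable def specMat (U : Matrix (Fin n) (Fin n) ℂ) (d : Fin n → ℝ) :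
    Matrix (Fin n) (Fin n) ℂ :=
  U * diagonal (fun i => (d i : ℂ)) * Uᴴ

lemma specMat_mul {U : Matrix (Fin n) (Fin n) ℂ} (hU : Uᴴ * U = 1) (d e : Fin n → ℝ) :
    specMat U d * specMat U e = specMat U (fun i => d i * e i) := by
  have : diagonal (fun i => ((d i * e i : ℝ) : ℂ)) =
      diagonal (fun i => (d i : ℂ)) * (Uᴴ * U) * diagonal (fun i => (e i : ℂ)) := by
    simp [hU]
  simp only [specMat, this, Matrix.mul_assoc]

lemma reTr_specMat {U : Matrix (Fin n) (Fin n) ℂ} (hU : Uᴴ * U = 1) (d : Fin n → ℝ) :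
    reTr (specMat U d) = ∑ i, d i := by
  rw [specMat, reTr_mul_comm, ← Matrix.mul_assoc, hU, one_mul, reTr, trace_diagonal]
  simp

lemma isHermitian_specMat (U : Matrix (Fin n) (Fin n) ℂ) (d : Fin n → ℝ) :
    (specMat U d).IsHermitian := by
  rw [specMat]
  apply isHermitian_mul_mul_conjTranspose
  rw [isHermitian_diagonal_iff]
  intro i
  simp [IsSelfAdjoint]

lemma posDef_diagonal_ofReal {d : Fin n → ℝ} (hd : ∀ i, 0 < d i) :
    (diagonal fun i => (d i : ℂ)).PosDef := by
  rw [posDef_diagonal_iff]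
  intro i
  exact_mod_cast hd i

lemma posDef_specMat {U : Matrix (Fin n) (Fin n) ℂ} (hU : Uᴴ * U = 1) {d : Fin n → ℝ}
    (hd : ∀ i, 0 < d i) : (specMat U d).PosDef := by
  refine (posDef_diagonal_ofReal hd).mul_mul_conjTranspose_same ?_
  intro x y hxy
  have := congrArg (fun v => v ᵥ* Uᴴ) hxy
  simpa [Matrix.vecMul_vecMul, mul_eq_one_comm.1 hU] using this

lemma specMat_one_right {U : Matrix (Fin n) (Fin n) ℂ} (hU : Uᴴ * U = 1) :
    specMat U (fun _ => 1) = 1 := by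
  simp [specMat, mul_eq_one_comm.1 hU]

lemma mpow_of_isHermitian {A : Matrix (Fin n) (Fin n) ℂ} (h : A.IsHermitian) (r : ℝ) :
    mpow A r = specMat h.eigenvectorUnitary (fun i => h.eigenvalues i ^ r) := by
  simp [mpow, h, specMat, star_eq_conjTranspose]

lemma eigenvectorUnitary_conjTranspose_mul {A : Matrix (Fin n) (Fin n) ℂ} (h : A.IsHermitian) :
    (h.eigenvectorUnitary : Matrix (Fin n) (Fin n) ℂ)ᴴ * h.eigenvectorUnitary = 1 := by
  rw [← star_eq_conjTranspose]
  exact Unitary.coe_star_mul_self _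

lemma eq_specMat_eigenvalues {A : Matrix (Fin n) (Fin n) ℂ} (h : A.IsHermitian) :
    A = specMat h.eigenvectorUnitary h.eigenvalues := by
  conv_lhs => rw [h.spectral_theorem]
  simp [specMat, Unitary.conjStarAlgAut_apply, star_eq_conjTranspose, Function.comp_def]

/-- The spectral functional calculus does not depend on the choice of an eigenbasis. -/
lemma mpow_specMat {U : Matrix (Fin n) (Fin n) ℂ} (hU : Uᴴ * U = 1) (d : Fin n → ℝ) (r : ℝ) :
    mpow (specMat U d) r = specMat U (fun i => d i ^ r) := by
  have h := isHermitian_specMat U d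
  rw [mpow_of_isHermitian h]
  have hV := eigenvectorUnitary_conjTranspose_mul h
  have he := eq_specMat_eigenvalues h
  generalize (h.eigenvectorUnitary : Matrix (Fin n) (Fin n) ℂ) = V at hV he ⊢
  generalize h.eigenvalues = e at he ⊢
  have hU' := mul_eq_one_comm.1 hU
  have hV' := mul_eq_one_comm.1 hV
  have key : (Vᴴ * U) * diagonal (fun i => (d i : ℂ)) =
      diagonal (fun i => (e i : ℂ)) * (Vᴴ * U) := by
    calc (Vᴴ * U) * diagonal (fun i => (d i : ℂ))
        = Vᴴ * specMat U d * U := by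
          simp only [specMat, Matrix.mul_assoc, hU, Matrix.mul_one]
      _ = Vᴴ * specMat V e * U := by rw [← he]
      _ = _ := by
          simp only [specMat, ← Matrix.mul_assoc, hV, Matrix.one_mul]
  have key2 : (Vᴴ * U) * diagonal (fun i => ((d i ^ r : ℝ) : ℂ)) =
      diagonal (fun i => ((e i ^ r : ℝ) : ℂ)) * (Vᴴ * U) := by
    ext i j
    have := congrFun (congrFun key i) j
    rw [mul_diagonal, diagonal_mul] at this ⊢
    by_cases h0 : (Vᴴ * U) i j = 0
    · simp [h0]
    · rw [mul_comm] at this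
      have h1 : d j = e i := by exact_mod_cast mul_right_cancel₀ h0 this
      rw [h1, mul_comm]
  calc specMat V (fun i => e i ^ r)
      = V * (diagonal (fun i => ((e i ^ r : ℝ) : ℂ)) * (Vᴴ * U)) * Uᴴ := by
        simp only [specMat, Matrix.mul_assoc, hU', Matrix.mul_one]
    _ = specMat U (fun i => d i ^ r) := by
        rw [← key2]
        simp only [specMat, ← Matrix.mul_assoc, hV', Matrix.one_mul]

lemma exists_specMat {A : Matrix (Fin n) (Fin n) ℂ} (hA : A.PosDef) :
    ∃ (U : Matrix (Fin n) (Fin n) ℂ) (d : Fin n → ℝ),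
      Uᴴ * U = 1 ∧ (∀ i, 0 < d i) ∧ A = specMat U d :=
  ⟨_, _, eigenvectorUnitary_conjTranspose_mul hA.1, hA.eigenvalues_pos,
    eq_specMat_eigenvalues hA.1⟩

lemma posDef_mpow {A : Matrix (Fin n) (Fin n) ℂ} (hA : A.PosDef) (r : ℝ) : (mpow A r).PosDef := by
  obtain ⟨U, d, hU, hd, rfl⟩ := exists_specMat hA
  rw [mpow_specMat hU]
  exact posDef_specMat hU fun i => Real.rpow_pos_of_pos (hd i) r

lemma mpow_mul_mpow {A : Matrix (Fin n) (Fin n) ℂ} (hA : A.PosDef) (r s : ℝ) :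
    mpow A r * mpow A s = mpow A (r + s) := by
  obtain ⟨U, d, hU, hd, rfl⟩ := exists_specMat hA
  simp only [mpow_specMat hU, specMat_mul hU, Real.rpow_add (hd _)]

lemma mpow_mpow {A : Matrix (Fin n) (Fin n) ℂ} (hA : A.PosDef) (r s : ℝ) :
    mpow (mpow A r) s = mpow A (r * s) := by
  obtain ⟨U, d, hU, hd, rfl⟩ := exists_specMat hA
  simp only [mpow_specMat hU, Real.rpow_mul (hd _).le]

lemma mpow_zero {A : Matrix (Fin n) (Fin n) ℂ} (hA : A.PosDef) : mpow A 0 = 1 := by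
  obtain ⟨U, d, hU, hd, rfl⟩ := exists_specMat hA
  simp only [mpow_specMat hU, Real.rpow_zero, specMat_one_right hU]

lemma mpow_one {A : Matrix (Fin n) (Fin n) ℂ} (hA : A.PosDef) : mpow A 1 = A := by
  obtain ⟨U, d, hU, hd, rfl⟩ := exists_specMat hA
  simp only [mpow_specMat hU, Real.rpow_one]

lemma mpow_conjTranspose (A : Matrix (Fin n) (Fin n) ℂ) (r : ℝ) : (mpow A r)ᴴ = mpow A r := by
  by_cases h : A.IsHermitian
  · rw [mpow_of_isHermitian h]
    exact isHermitian_specMat _ _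
  · simp [mpow, h]

lemma mpow_unitary_conj {A U : Matrix (Fin n) (Fin n) ℂ} (hA : A.PosDef) (hU : Uᴴ * U = 1)
    (r : ℝ) : mpow (U * A * Uᴴ) r = U * mpow A r * Uᴴ := by
  obtain ⟨V, d, hV, hd, rfl⟩ := exists_specMat hA
  have h (e : Fin n → ℝ) : U * specMat V e * Uᴴ = specMat (U * V) e := by
    simp only [specMat, conjTranspose_mul, Matrix.mul_assoc]
  have hUV : (U * V)ᴴ * (U * V) = 1 := by
    rw [conjTranspose_mul, Matrix.mul_assoc, ← Matrix.mul_assoc Uᴴ, hU, Matrix.one_mul, hV]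
  rw [h, mpow_specMat hUV, mpow_specMat hV, h]

/-- `Tr (S* S)^r = Tr (S S*)^r`. -/
lemma reTr_mpow_conjTranspose_mul {S : Matrix (Fin n) (Fin n) ℂ} (hS : (Sᴴ * S).PosDef) (r : ℝ) :
    reTr (mpow (Sᴴ * S) r) = reTr (mpow (S * Sᴴ) r) := by
  obtain ⟨U, d, hU, hd, hX⟩ := exists_specMat hS
  have hU' := mul_eq_one_comm.1 hU
  set D : Matrix (Fin n) (Fin n) ℂ := diagonal (fun i => ((d i ^ (-(1 / 2) : ℝ) : ℝ) : ℂ)) with hD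
  have hDH : Dᴴ = D := by
    exact (posDef_diagonal_ofReal fun i => Real.rpow_pos_of_pos (hd i) _).1
  have hDD : D * diagonal (fun i => (d i : ℂ)) * D = 1 := by
    rw [hD, diagonal_mul_diagonal, diagonal_mul_diagonal, ← diagonal_one]
    congr 1
    ext i
    have h1 : d i ^ (-(1 / 2) : ℝ) * d i * d i ^ (-(1 / 2) : ℝ) = 1 := by
      rw [mul_right_comm, ← Real.rpow_add (hd i)]
      norm_num [Real.rpow_neg_one, (hd i).ne']
    exact_mod_cast h1
  have hDD' : D * diagonal (fun i => (d i : ℂ)) * Dᴴ = 1 := by rw [hDH, hDD]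
  set V := S * U * D with hVdef
  have hV : Vᴴ * V = 1 := by
    calc Vᴴ * V = D * (Uᴴ * (Sᴴ * S) * U) * D := by
          simp only [hVdef, conjTranspose_mul, hDH, Matrix.mul_assoc]
      _ = D * ((Uᴴ * U) * diagonal (fun i => (d i : ℂ)) * (Uᴴ * U)) * D := by
          rw [hX]; simp only [specMat, Matrix.mul_assoc]
      _ = 1 := by rw [hU, Matrix.one_mul, Matrix.mul_one, hDD]
  have hSS : S * Sᴴ = specMat V d := by
    calc S * Sᴴ = S * (U * Uᴴ) * Sᴴ := by rw [hU', Matrix.mul_one]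
      _ = S * U * (D * diagonal (fun i => (d i : ℂ)) * Dᴴ) * Uᴴ * Sᴴ := by
          rw [hDD']; simp only [Matrix.mul_assoc, Matrix.one_mul]
      _ = specMat V d := by
          simp only [specMat, hVdef, conjTranspose_mul, Matrix.mul_assoc]
  rw [hSS, hX, mpow_specMat hU, mpow_specMat hV, reTr_specMat hU, reTr_specMat hV]

/-- The double spectral sum representing traces of products of functions of two matrices. -/
lemma reTr_conj_specMat_mul_specMat (K U V : Matrix (Fin n) (Fin n) ℂ) (b z : Fin n → ℝ) :
    reTr (Kᴴ * specMat U b * K * specMat V z) =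
      ∑ i, ∑ j, b i * z j * Complex.normSq ((Uᴴ * K * V) i j) := by
  set M := Uᴴ * K * V with hM
  have h : reTr (Kᴴ * specMat U b * K * specMat V z) =
      reTr (diagonal (fun i => (b i : ℂ)) * (M * (diagonal (fun i => (z i : ℂ)) * Mᴴ))) := by
    rw [reTr_mul_comm (diagonal _)]
    have : Kᴴ * specMat U b * K * specMat V z =
        (Kᴴ * U * diagonal (fun i => (b i : ℂ))) *
          (M * diagonal (fun i => (z i : ℂ)) * Vᴴ) := by
      simp only [specMat, hM, Matrix.mul_assoc]
    rw [this, reTr_mul_comm]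
    refine congrArg reTr ?_
    simp only [hM, conjTranspose_mul, conjTranspose_conjTranspose, Matrix.mul_assoc]
  rw [h, reTr, trace, Complex.re_sum]
  refine Finset.sum_congr rfl fun i _ => ?_
  rw [diag_apply, diagonal_mul, mul_apply, Finset.mul_sum, Complex.re_sum]
  refine Finset.sum_congr rfl fun j _ => ?_
  rw [diagonal_mul, conjTranspose_apply, Complex.star_def]
  have : (b i : ℂ) * (M i j * ((z j : ℂ) * (starRingEnd ℂ) (M i j))) =
      ((b i * z j * Complex.normSq (M i j) : ℝ) : ℂ) := by
    push_cast
    rw [← Complex.mul_conj]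
    ring
  rw [this, Complex.ofReal_re]

lemma sum_normSq_mul_left {M : Matrix (Fin n) (Fin n) ℂ} (hM : M * Mᴴ = 1) (i : Fin n) :
    ∑ j, Complex.normSq (M i j) = 1 := by
  have := congrFun (congrFun hM i) i
  rw [mul_apply, one_apply_eq] at this
  simp only [conjTranspose_apply, Complex.star_def, Complex.mul_conj] at this
  exact_mod_cast this

end SpectralCalculus

section Lieb

variable {n : ℕ}

/-- A generalized Klein inequality for traces of powers. -/
lemma reTr_mpow_klein {X W : Matrix (Fin n) (Fin n) ℂ} (hX : X.PosDef) (hW : W.PosDef)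
    {c₁ c₂ c₃ a b a' b' : ℝ}
    (h : ∀ x w : ℝ, 0 < x → 0 < w → 0 ≤ c₁ * x ^ a + c₂ * w ^ b + c₃ * (x ^ a' * w ^ b')) :
    0 ≤ c₁ * reTr (mpow X a) + c₂ * reTr (mpow W b) + c₃ * reTr (mpow X a' * mpow W b') := by
  obtain ⟨U, d, hU, hd, rfl⟩ := exists_specMat hX
  obtain ⟨V, e, hV, he, rfl⟩ := exists_specMat hW
  have h1 : reTr (specMat U fun i => d i ^ a) =
      ∑ i, ∑ j, d i ^ a * 1 * Complex.normSq ((Uᴴ * (1 : Matrix (Fin n) (Fin n) ℂ) * V) i j) := by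
    rw [← reTr_conj_specMat_mul_specMat, specMat_one_right hV]
    simp
  have h2 : reTr (specMat V fun i => e i ^ b) =
      ∑ i, ∑ j, 1 * e j ^ b * Complex.normSq ((Uᴴ * (1 : Matrix (Fin n) (Fin n) ℂ) * V) i j) := by
    rw [← reTr_conj_specMat_mul_specMat 1 U V (fun _ => 1), specMat_one_right hU]
    simp
  have h3 : reTr ((specMat U fun i => d i ^ a') * specMat V fun i => e i ^ b') =
      ∑ i, ∑ j, d i ^ a' * e j ^ b' *
        Complex.normSq ((Uᴴ * (1 : Matrix (Fin n) (Fin n) ℂ) * V) i j) := by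
    rw [← reTr_conj_specMat_mul_specMat]
    simp
  simp only [mpow_specMat hU, mpow_specMat hV]
  rw [h1, h2, h3]
  simp only [Finset.mul_sum, ← Finset.sum_add_distrib]
  refine Finset.sum_nonneg fun i _ => Finset.sum_nonneg fun j _ => ?_
  have := mul_nonneg (h (d i) (e j) (hd i) (he j))
    (Complex.normSq_nonneg ((Uᴴ * (1 : Matrix (Fin n) (Fin n) ℂ) * V) i j))
  linarith

lemma posDef_combination {A B : Matrix (Fin n) (Fin n) ℂ} (hA : A.PosDef) (hB : B.PosDef)
    {t : ℝ} (h0 : 0 ≤ t) (h1 : t ≤ 1) : (t • A + (1 - t) • B).PosDef := by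
  rcases h0.eq_or_lt with rfl | h0
  · simpa using hB
  · exact (hA.smul h0).add_posSemidef (hB.posSemidef.smul (by linarith))

lemma normSq_parallel_le (v w : ℂ) {t b z : ℝ} (ht : 0 < t) (hb : 0 < b) (hz : 0 < z) :
    b * z / (t * z + b) * Complex.normSq (v + w) ≤
      t⁻¹ * (b * 1 * Complex.normSq v) + 1 * z * Complex.normSq w := by
  have hpos : 0 < t * z + b := by positivity
  have : t⁻¹ * (b * 1 * Complex.normSq v) + 1 * z * Complex.normSq w
      - b * z / (t * z + b) * Complex.normSq (v + w) =
      ((v.re * b - w.re * (t * z)) ^ 2 + (v.im * b - w.im * (t * z)) ^ 2) / (t * (t * z + b)) := by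
    simp only [Complex.normSq_apply, Complex.add_re, Complex.add_im]
    field_simp
    ring
  have h2 : 0 ≤ ((v.re * b - w.re * (t * z)) ^ 2 + (v.im * b - w.im * (t * z)) ^ 2) /
      (t * (t * z + b)) := by positivity
  linarith

/-- The double spectral sum of the parallel sum kernel is bounded by the values of a
quadratic functional. -/
lemma sum_parallel_le {U V : Matrix (Fin n) (Fin n) ℂ} (hU : Uᴴ * U = 1) {b z : Fin n → ℝ}
    (hb : ∀ i, 0 < b i) (hz : ∀ i, 0 < z i) {t : ℝ} (ht : 0 < t)
    (K W : Matrix (Fin n) (Fin n) ℂ) (hV : Vᴴ * V = 1) :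
    ∑ i, ∑ j, b i * z j / (t * z j + b i) * Complex.normSq ((Uᴴ * K * V) i j) ≤
      t⁻¹ * reTr (Wᴴ * specMat U b * W) + reTr ((K - W)ᴴ * (K - W) * specMat V z) := by
  have h1 : reTr (Wᴴ * specMat U b * W) =
      ∑ i, ∑ j, b i * 1 * Complex.normSq ((Uᴴ * W * V) i j) := by
    rw [← reTr_conj_specMat_mul_specMat, specMat_one_right hV]
    simp
  have h2 : reTr ((K - W)ᴴ * (K - W) * specMat V z) =
      ∑ i, ∑ j, 1 * z j * Complex.normSq ((Uᴴ * (K - W) * V) i j) := by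
    rw [← reTr_conj_specMat_mul_specMat (K - W) U V (fun _ => 1), specMat_one_right hU]
    simp
  rw [h1, h2]
  simp only [Finset.mul_sum, ← Finset.sum_add_distrib]
  refine Finset.sum_le_sum fun i _ => Finset.sum_le_sum fun j _ => ?_
  have h3 : (Uᴴ * K * V) i j = (Uᴴ * W * V) i j + (Uᴴ * (K - W) * V) i j := by
    rw [← Matrix.add_apply, ← Matrix.add_mul, ← Matrix.mul_add]
    simp
  rw [h3]
  exact normSq_parallel_le _ _ ht (hb i) (hz j)

/-- The bound in `sum_parallel_le` is attained. -/
lemma exists_sum_parallel_eq {U V : Matrix (Fin n) (Fin n) ℂ} (hU : Uᴴ * U = 1) {b z : Fin n → ℝ}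
    (hb : ∀ i, 0 < b i) (hz : ∀ i, 0 < z i) {t : ℝ} (ht : 0 < t)
    (K : Matrix (Fin n) (Fin n) ℂ) (hV : Vᴴ * V = 1) :
    ∃ W : Matrix (Fin n) (Fin n) ℂ,
      t⁻¹ * reTr (Wᴴ * specMat U b * W) + reTr ((K - W)ᴴ * (K - W) * specMat V z) =
      ∑ i, ∑ j, b i * z j / (t * z j + b i) * Complex.normSq ((Uᴴ * K * V) i j) := by
  set N : Matrix (Fin n) (Fin n) ℂ :=
    Matrix.of fun i j => ((t * z j / (t * z j + b i) : ℝ) : ℂ) * (Uᴴ * K * V) i j with hN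
  set W := U * N * Vᴴ with hWdef
  refine ⟨W, ?_⟩
  have hW : Uᴴ * W * V = N := by
    calc Uᴴ * W * V = (Uᴴ * U) * N * (Vᴴ * V) := by simp only [hWdef, Matrix.mul_assoc]
      _ = N := by rw [hU, hV, Matrix.one_mul, Matrix.mul_one]
  have h1 : reTr (Wᴴ * specMat U b * W) =
      ∑ i, ∑ j, b i * 1 * Complex.normSq ((Uᴴ * W * V) i j) := by
    rw [← reTr_conj_specMat_mul_specMat, specMat_one_right hV]
    simp
  have h2 : reTr ((K - W)ᴴ * (K - W) * specMat V z) =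
      ∑ i, ∑ j, 1 * z j * Complex.normSq ((Uᴴ * (K - W) * V) i j) := by
    rw [← reTr_conj_specMat_mul_specMat (K - W) U V (fun _ => 1), specMat_one_right hU]
    simp
  rw [h1, h2]
  simp only [Finset.mul_sum, ← Finset.sum_add_distrib]
  refine Finset.sum_congr rfl fun i _ => Finset.sum_congr rfl fun j _ => ?_
  have hb := hb i
  have hz := hz j
  have hpos : 0 < t * z j + b i := by positivity
  have h3 : (Uᴴ * (K - W) * V) i j = ((b i / (t * z j + b i) : ℝ) : ℂ) * (Uᴴ * K * V) i j := by
    rw [Matrix.mul_sub, Matrix.sub_mul, hW, Matrix.sub_apply, hN, Matrix.of_apply]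
    have : ((b i / (t * z j + b i) : ℝ) : ℂ) = 1 - ((t * z j / (t * z j + b i) : ℝ) : ℂ) := by
      rw [← Complex.ofReal_one, ← Complex.ofReal_sub]
      congr 1
      field_simp
      ring
    rw [this]
    ring
  rw [h3, hW, hN, Matrix.of_apply, Complex.normSq_mul, Complex.normSq_mul, Complex.normSq_ofReal,
    Complex.normSq_ofReal]
  field_simp

lemma rpow_mul_rpow_eq_integral {p : ℝ} (hp : p ∈ Set.Ioo (0 : ℝ) 1) {b z : ℝ} (hb : 0 < b)
    (hz : 0 < z) :
    MeasureTheory.IntegrableOn (fun t => t ^ (p - 1) * (b * z / (t * z + b))) (Set.Ioi 0) ∧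
      b ^ p * z ^ (1 - p) = (∫ t in Set.Ioi 0, Real.rpowIntegrand₀₁ p t 1)⁻¹ *
        ∫ t in Set.Ioi 0, t ^ (p - 1) * (b * z / (t * z + b)) := by
  have hbz : 0 ≤ b / z := by positivity
  have heq : Set.EqOn (fun t => z * Real.rpowIntegrand₀₁ p t (b / z))
      (fun t => t ^ (p - 1) * (b * z / (t * z + b))) (Set.Ioi 0) := by
    intro t ht
    have ht : 0 < t := ht
    dsimp only
    rw [Real.rpowIntegrand₀₁_eq_pow_div hp ht.le hbz]
    field_simp
  refine ⟨?_, ?_⟩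
  · refine MeasureTheory.IntegrableOn.congr_fun ?_ heq measurableSet_Ioi
    exact (Real.integrableOn_rpowIntegrand₀₁_Ioi hp hbz).const_mul z
  · rw [← MeasureTheory.setIntegral_congr_fun measurableSet_Ioi heq,
      MeasureTheory.integral_const_mul, mul_left_comm, ← Real.rpow_eq_const_mul_integral hp hbz,
      Real.div_rpow hb.le hz.le, Real.rpow_sub hz, Real.rpow_one]
    field_simp

lemma sum_rpow_eq_integral {p : ℝ} (hp : p ∈ Set.Ioo (0 : ℝ) 1) {b z : Fin n → ℝ}
    (hb : ∀ i, 0 < b i) (hz : ∀ i, 0 < z i) (c : Fin n → Fin n → ℝ) :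
    MeasureTheory.IntegrableOn
      (fun t => t ^ (p - 1) * ∑ i, ∑ j, b i * z j / (t * z j + b i) * c i j) (Set.Ioi 0) ∧
    ∑ i, ∑ j, b i ^ p * z j ^ (1 - p) * c i j =
      (∫ t in Set.Ioi 0, Real.rpowIntegrand₀₁ p t 1)⁻¹ *
        ∫ t in Set.Ioi 0, t ^ (p - 1) * ∑ i, ∑ j, b i * z j / (t * z j + b i) * c i j := by
  have heq : (fun t : ℝ => t ^ (p - 1) * ∑ i, ∑ j, b i * z j / (t * z j + b i) * c i j) =
      fun t => ∑ i, ∑ j, t ^ (p - 1) * (b i * z j / (t * z j + b i)) * c i j := by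
    ext t
    simp only [Finset.mul_sum, mul_assoc]
  have hint (i j : Fin n) : MeasureTheory.IntegrableOn
      (fun t => t ^ (p - 1) * (b i * z j / (t * z j + b i)) * c i j) (Set.Ioi 0) :=
    (rpow_mul_rpow_eq_integral hp (hb i) (hz j)).1.mul_const _
  rw [heq]
  refine ⟨MeasureTheory.integrable_finsetSum _ fun i _ =>
    MeasureTheory.integrable_finsetSum _ fun j _ => hint i j, ?_⟩
  rw [MeasureTheory.integral_finsetSum _ fun i _ =>
    MeasureTheory.integrable_finsetSum _ fun j _ => hint i j, Finset.mul_sum]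
  refine Finset.sum_congr rfl fun i _ => ?_
  rw [MeasureTheory.integral_finsetSum _ fun j _ => hint i j, Finset.mul_sum]
  refine Finset.sum_congr rfl fun j _ => ?_
  rw [MeasureTheory.integral_mul_const, ← mul_assoc,
    ← (rpow_mul_rpow_eq_integral hp (hb i) (hz j)).2]

/-- Lieb's concavity theorem in the homogeneous case. -/
lemma lieb_concave_homogeneous {p : ℝ} (hp : p ∈ Set.Ioo (0 : ℝ) 1)
    (K : Matrix (Fin n) (Fin n) ℂ) {B₁ B₂ Z₁ Z₂ : Matrix (Fin n) (Fin n) ℂ}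
    (hB₁ : B₁.PosDef) (hB₂ : B₂.PosDef) (hZ₁ : Z₁.PosDef) (hZ₂ : Z₂.PosDef)
    {t : ℝ} (h0 : 0 ≤ t) (h1 : t ≤ 1) :
    t * reTr (Kᴴ * mpow B₁ p * K * mpow Z₁ (1 - p)) +
        (1 - t) * reTr (Kᴴ * mpow B₂ p * K * mpow Z₂ (1 - p)) ≤
      reTr (Kᴴ * mpow (t • B₁ + (1 - t) • B₂) p * K * mpow (t • Z₁ + (1 - t) • Z₂) (1 - p)) := by
  obtain ⟨U, b, hU, hb, hB⟩ := exists_specMat (posDef_combination hB₁ hB₂ h0 h1)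
  obtain ⟨V, z, hV, hz, hZ⟩ := exists_specMat (posDef_combination hZ₁ hZ₂ h0 h1)
  obtain ⟨U₁, b₁, hU₁, hb₁, rfl⟩ := exists_specMat hB₁
  obtain ⟨U₂, b₂, hU₂, hb₂, rfl⟩ := exists_specMat hB₂
  obtain ⟨V₁, z₁, hV₁, hz₁, rfl⟩ := exists_specMat hZ₁
  obtain ⟨V₂, z₂, hV₂, hz₂, rfl⟩ := exists_specMat hZ₂
  rw [hB, hZ]
  simp only [mpow_specMat hU, mpow_specMat hV, mpow_specMat hU₁, mpow_specMat hV₁,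
    mpow_specMat hU₂, mpow_specMat hV₂, reTr_conj_specMat_mul_specMat]
  obtain ⟨hi, he⟩ := sum_rpow_eq_integral hp hb hz
    (fun i j => Complex.normSq ((Uᴴ * K * V) i j))
  obtain ⟨hi₁, he₁⟩ := sum_rpow_eq_integral hp hb₁ hz₁
    (fun i j => Complex.normSq ((U₁ᴴ * K * V₁) i j))
  obtain ⟨hi₂, he₂⟩ := sum_rpow_eq_integral hp hb₂ hz₂
    (fun i j => Complex.normSq ((U₂ᴴ * K * V₂) i j))
  rw [he, he₁, he₂, mul_left_comm t, mul_left_comm (1 - t), ← mul_add,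
    ← MeasureTheory.integral_const_mul, ← MeasureTheory.integral_const_mul,
    ← MeasureTheory.integral_add (hi₁.const_mul _) (hi₂.const_mul _)]
  refine mul_le_mul_of_nonneg_left ?_ (inv_nonneg.2 (Real.integral_rpowIntegrand₀₁_one_pos hp).le)
  refine MeasureTheory.setIntegral_mono_on ((hi₁.const_mul _).add (hi₂.const_mul _)) hi
    measurableSet_Ioi fun x hx => ?_
  have hx : 0 < x := hx
  obtain ⟨W, hW⟩ := exists_sum_parallel_eq hU hb hz hx K hV
  have hW₁ := sum_parallel_le hU₁ hb₁ hz₁ hx K W hV₁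
  have hW₂ := sum_parallel_le hU₂ hb₂ hz₂ hx K W hV₂
  rw [← hB, ← hZ] at hW
  simp only [Matrix.mul_add, Matrix.add_mul, Matrix.mul_smul, Matrix.smul_mul, reTr_add,
    reTr_smul] at hW
  rw [mul_left_comm t, mul_left_comm (1 - t), ← mul_add]
  refine mul_le_mul_of_nonneg_left ?_ (Real.rpow_nonneg hx.le _)
  rw [← hW]
  have := add_le_add (mul_le_mul_of_nonneg_left hW₁ h0)
    (mul_le_mul_of_nonneg_left hW₂ (sub_nonneg.2 h1))
  refine this.trans (le_of_eq ?_)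
  ring

end Lieb

section OperatorConcavity

open scoped MatrixOrder Matrix.Norms.L2Operator

variable {n : ℕ}

lemma mpow_eq_rpow {A : Matrix (Fin n) (Fin n) ℂ} (hA : A.PosDef) (r : ℝ) : mpow A r = A ^ r := by
  have h0 : (0 : Matrix (Fin n) (Fin n) ℂ) ≤ A := hA.posSemidef.nonneg
  have hu : IsUnit A := hA.isUnit
  rw [CFC.rpow_eq_cfc_real h0, hA.1.cfc_eq, mpow_of_isHermitian hA.1]
  simp [specMat, IsHermitian.cfc, Unitary.conjStarAlgAut_apply, star_eq_conjTranspose,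
    Function.comp_def]

/-- Operator concavity of real powers with exponent in `[0, 1]`. -/
lemma posSemidef_mpow_combination_sub {A B : Matrix (Fin n) (Fin n) ℂ} (hA : A.PosDef)
    (hB : B.PosDef) {r : ℝ} (hr : r ∈ Set.Icc (0 : ℝ) 1) {t : ℝ} (h0 : 0 ≤ t) (h1 : t ≤ 1) :
    (mpow (t • A + (1 - t) • B) r - (t • mpow A r + (1 - t) • mpow B r)).PosSemidef := by
  have := (CFC.concaveOn_rpow (A := Matrix (Fin n) (Fin n) ℂ) hr).2 hA.posSemidef.nonneg
    hB.posSemidef.nonneg h0 (sub_nonneg.2 h1) (by ring)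
  rw [mpow_eq_rpow (posDef_combination hA hB h0 h1), mpow_eq_rpow hA, mpow_eq_rpow hB]
  exact this

/-- Operator monotonicity of real powers with exponent in `[0, 1]`. -/
lemma posSemidef_mpow_sub {A B : Matrix (Fin n) (Fin n) ℂ} (hA : A.PosDef)
    (hB : B.PosDef) {r : ℝ} (hr : r ∈ Set.Icc (0 : ℝ) 1) (hAB : (B - A).PosSemidef) :
    (mpow B r - mpow A r).PosSemidef := by
  rw [mpow_eq_rpow hA, mpow_eq_rpow hB]
  exact CFC.monotone_rpow hr (Matrix.le_iff.2 hAB)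

end OperatorConcavity

section Epstein

variable {n : ℕ}

lemma reTr_conj_mul_nonneg {D X : Matrix (Fin n) (Fin n) ℂ} (hD : D.PosSemidef) (hX : X.PosDef)
    (K : Matrix (Fin n) (Fin n) ℂ) : 0 ≤ reTr (Kᴴ * X * K * D) := by
  obtain ⟨U, d, hU, hd, rfl⟩ := exists_specMat hX
  rw [eq_specMat_eigenvalues hD.1, reTr_conj_specMat_mul_specMat]
  exact Finset.sum_nonneg fun i _ => Finset.sum_nonneg fun j _ =>
    mul_nonneg (mul_nonneg (hd i).le (hD.eigenvalues_nonneg j)) (Complex.normSq_nonneg _)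

lemma reTr_conj_mul_nonneg' {D X : Matrix (Fin n) (Fin n) ℂ} (hD : D.PosSemidef) (hX : X.PosDef)
    (K : Matrix (Fin n) (Fin n) ℂ) : 0 ≤ reTr (Kᴴ * D * K * X) := by
  obtain ⟨U, d, hU, hd, rfl⟩ := exists_specMat hX
  rw [eq_specMat_eigenvalues hD.1, reTr_conj_specMat_mul_specMat]
  exact Finset.sum_nonneg fun i _ => Finset.sum_nonneg fun j _ =>
    mul_nonneg (mul_nonneg (hD.eigenvalues_nonneg i) (hd j).le) (Complex.normSq_nonneg _)

lemma reTr_conj_mpow_mul_concave {p : ℝ} (hp : p ∈ Set.Icc (0 : ℝ) 1)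
    (K : Matrix (Fin n) (Fin n) ℂ) {B₁ B₂ Y : Matrix (Fin n) (Fin n) ℂ}
    (hB₁ : B₁.PosDef) (hB₂ : B₂.PosDef) (hY : Y.PosDef) {t : ℝ} (h0 : 0 ≤ t) (h1 : t ≤ 1) :
    t * reTr (Kᴴ * mpow B₁ p * K * Y) + (1 - t) * reTr (Kᴴ * mpow B₂ p * K * Y) ≤
      reTr (Kᴴ * mpow (t • B₁ + (1 - t) • B₂) p * K * Y) := by
  have := reTr_conj_mul_nonneg' (posSemidef_mpow_combination_sub hB₁ hB₂ hp h0 h1) hY K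
  simp only [Matrix.mul_sub, Matrix.sub_mul, Matrix.mul_add, Matrix.add_mul, Matrix.mul_smul,
    Matrix.smul_mul, reTr_add, reTr_sub, reTr_smul] at this
  linarith

/-- Lieb's concavity theorem. -/
lemma lieb_concave {p a : ℝ} (hp : 0 < p) (ha : 0 < a) (hpa : p + a ≤ 1)
    (K : Matrix (Fin n) (Fin n) ℂ) {B₁ B₂ Z₁ Z₂ : Matrix (Fin n) (Fin n) ℂ}
    (hB₁ : B₁.PosDef) (hB₂ : B₂.PosDef) (hZ₁ : Z₁.PosDef) (hZ₂ : Z₂.PosDef)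
    {t : ℝ} (h0 : 0 ≤ t) (h1 : t ≤ 1) :
    t * reTr (Kᴴ * mpow B₁ p * K * mpow Z₁ a) + (1 - t) * reTr (Kᴴ * mpow B₂ p * K * mpow Z₂ a) ≤
      reTr (Kᴴ * mpow (t • B₁ + (1 - t) • B₂) p * K * mpow (t • Z₁ + (1 - t) • Z₂) a) := by
  have hp1 : 0 < 1 - p := by linarith
  set c := a / (1 - p) with hc
  have hc0 : 0 ≤ c := by positivity
  have hc1 : c ≤ 1 := by rw [hc, div_le_one hp1]; linarith
  have hca : c * (1 - p) = a := by rw [hc]; field_simp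
  have hZ := posDef_combination hZ₁ hZ₂ h0 h1
  have hlieb := lieb_concave_homogeneous ⟨hp, by linarith⟩ K hB₁ hB₂ (posDef_mpow hZ₁ c)
    (posDef_mpow hZ₂ c) h0 h1
  rw [mpow_mpow hZ₁, mpow_mpow hZ₂, hca] at hlieb
  refine hlieb.trans ?_
  have hmono := posSemidef_mpow_sub
    (posDef_combination (posDef_mpow hZ₁ c) (posDef_mpow hZ₂ c) h0 h1) (posDef_mpow hZ c)
    (r := 1 - p) ⟨hp1.le, by linarith⟩
    (posSemidef_mpow_combination_sub hZ₁ hZ₂ ⟨hc0, hc1⟩ h0 h1)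
  rw [mpow_mpow hZ, hca] at hmono
  have := reTr_conj_mul_nonneg hmono (posDef_mpow (posDef_combination hB₁ hB₂ h0 h1) p) K
  rw [Matrix.mul_sub, reTr_sub] at this
  linarith

lemma posDef_conj {K A : Matrix (Fin n) (Fin n) ℂ} (hK : IsUnit K) (hA : A.PosDef) :
    (Kᴴ * A * K).PosDef :=
  (hK.posDef_star_left_conjugate_iff).2 hA

/-- Epstein's concavity theorem. -/
lemma epstein_concave {p r : ℝ} (hp : 0 < p) (hp1 : p ≤ 1) (hr : 0 < r) (hrp : r * p ≤ 1)
    {K : Matrix (Fin n) (Fin n) ℂ} (hK : IsUnit K) {B₁ B₂ : Matrix (Fin n) (Fin n) ℂ}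
    (hB₁ : B₁.PosDef) (hB₂ : B₂.PosDef) {t : ℝ} (h0 : 0 ≤ t) (h1 : t ≤ 1) :
    t * reTr (mpow (Kᴴ * mpow B₁ p * K) r) + (1 - t) * reTr (mpow (Kᴴ * mpow B₂ p * K) r) ≤
      reTr (mpow (Kᴴ * mpow (t • B₁ + (1 - t) • B₂) p * K) r) := by
  have hB := posDef_combination hB₁ hB₂ h0 h1
  have hX₁ := posDef_conj hK (posDef_mpow hB₁ p)
  have hX₂ := posDef_conj hK (posDef_mpow hB₂ p)
  have hX := posDef_conj hK (posDef_mpow hB p)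
  set X₁ := Kᴴ * mpow B₁ p * K with hX₁def
  set X₂ := Kᴴ * mpow B₂ p * K with hX₂def
  set X := Kᴴ * mpow (t • B₁ + (1 - t) • B₂) p * K with hXdef
  have h1' := sub_nonneg.2 h1
  rcases le_or_gt r 1 with hr1 | hr1
  · have tangent {X' : Matrix (Fin n) (Fin n) ℂ} (hX' : X'.PosDef) :
        reTr (mpow X' r) ≤ r * reTr (X' * mpow X (r - 1)) + (1 - r) * reTr (mpow X r) := by
      have := reTr_mpow_klein hX' hX (c₁ := -1) (c₂ := 1 - r) (c₃ := r) (a := r) (b := r)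
        (a' := 1) (b' := r - 1) fun x w hx hw => by
          have h := Real.geom_mean_le_arith_mean2_weighted hr.le (sub_nonneg.2 hr1)
            (p₁ := x * w ^ (r - 1)) (p₂ := w ^ r) (by positivity) (by positivity) (by ring)
          have h2 : (x * w ^ (r - 1)) ^ r * (w ^ r) ^ (1 - r) = x ^ r := by
            rw [Real.mul_rpow hx.le (by positivity), ← Real.rpow_mul hw.le, ← Real.rpow_mul hw.le,
              mul_assoc, ← Real.rpow_add hw]
            ring_nf
            simp
          rw [h2] at h
          rw [Real.rpow_one]
          linarith
      rw [mpow_one hX'] at this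
      linarith
    have hconc := reTr_conj_mpow_mul_concave ⟨hp.le, hp1⟩ K hB₁ hB₂ (posDef_mpow hX (r - 1)) h0 h1
    rw [← hX₁def, ← hX₂def, ← hXdef] at hconc
    have heq : reTr (X * mpow X (r - 1)) = reTr (mpow X r) := by
      nth_rewrite 1 [← mpow_one hX]
      rw [mpow_mul_mpow hX]
      ring_nf
    rw [heq] at hconc
    nlinarith [mul_le_mul_of_nonneg_left (tangent hX₁) h0,
      mul_le_mul_of_nonneg_left (tangent hX₂) h1', mul_le_mul_of_nonneg_left hconc hr.le]
  · have hr0 : 0 < 1 - r⁻¹ := by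
      have := inv_lt_one_of_one_lt₀ hr1
      linarith
    have hpr : p + (1 - r⁻¹) ≤ 1 := by
      have : p ≤ r⁻¹ := by rw [← one_div, le_div_iff₀ hr]; linarith
      linarith
    have young {W : Matrix (Fin n) (Fin n) ℂ} (hW : W.PosDef) :
        r * reTr (X * mpow W (1 - r⁻¹)) ≤ reTr (mpow X r) + (r - 1) * reTr W := by
      have := reTr_mpow_klein hX hW (c₁ := 1) (c₂ := r - 1) (c₃ := -r) (a := r) (b := 1)
        (a' := 1) (b' := 1 - r⁻¹) fun x w hx hw => by
          have h := Real.geom_mean_le_arith_mean2_weighted (inv_nonneg.2 hr.le) hr0.le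
            (p₁ := x ^ r) (p₂ := w) (by positivity) (by positivity) (by ring)
          rw [← Real.rpow_mul hx.le, mul_inv_cancel₀ hr.ne'] at h
          have h2 := mul_le_mul_of_nonneg_left h hr.le
          have h3 : r * (r⁻¹ * x ^ r + (1 - r⁻¹) * w) = x ^ r + (r - 1) * w := by
            field_simp
          rw [h3] at h2
          rw [Real.rpow_one w]
          linarith
      rw [mpow_one hX, mpow_one hW] at this
      linarith
    have hconc := lieb_concave hp hr0 hpr K hB₁ hB₂ (posDef_mpow hX₁ r) (posDef_mpow hX₂ r) h0 h1
    rw [← hX₁def, ← hX₂def, ← hXdef] at hconc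
    have heq {Y : Matrix (Fin n) (Fin n) ℂ} (hY : Y.PosDef) :
        reTr (Y * mpow (mpow Y r) (1 - r⁻¹)) = reTr (mpow Y r) := by
      have : 1 + r * (1 - r⁻¹) = r := by field_simp; ring
      nth_rewrite 1 [← mpow_one hY]
      rw [mpow_mpow hY, mpow_mul_mpow hY, this]
    rw [heq hX₁, heq hX₂] at hconc
    have hy := young (posDef_combination (posDef_mpow hX₁ r) (posDef_mpow hX₂ r) h0 h1)
    rw [reTr_add, reTr_smul, reTr_smul] at hy
    nlinarith [mul_le_mul_of_nonneg_left hconc hr.le]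

end Epstein

section Young

variable {n : ℕ}

/-- The diagonal unitary which flips the sign of the `k`-th basis vector. -/
noncomputable def signFlip (k : Fin n) : Matrix (Fin n) (Fin n) ℂ :=
  diagonal fun i => if i = k then -1 else 1

lemma signFlip_conjTranspose (k : Fin n) : (signFlip k)ᴴ = signFlip k := by
  rw [signFlip, diagonal_conjTranspose]
  congr 1
  ext i
  by_cases h : i = k <;> simp [h]

lemma signFlip_mul_self (k : Fin n) : signFlip k * signFlip k = 1 := by
  rw [signFlip, diagonal_mul_diagonal, ← diagonal_one]
  congr 1
  ext i
  by_cases h : i = k <;> simp [h]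

/-- The matrix obtained from `C` by deleting the off-diagonal entries in the rows and columns
indexed by `S`. -/
def partialPinch (S : Finset (Fin n)) (C : Matrix (Fin n) (Fin n) ℂ) :
    Matrix (Fin n) (Fin n) ℂ :=
  Matrix.of fun i j => if i = j ∨ (i ∉ S ∧ j ∉ S) then C i j else 0

lemma partialPinch_insert (S : Finset (Fin n)) (k : Fin n) (C : Matrix (Fin n) (Fin n) ℂ) :
    partialPinch (insert k S) C = (1 / 2 : ℝ) • partialPinch S C +
      (1 - 1 / 2 : ℝ) • ((signFlip k)ᴴ * partialPinch S C * signFlip k) := by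
  ext i j
  rw [signFlip_conjTranspose]
  simp only [signFlip, Matrix.add_apply, Matrix.smul_apply, mul_diagonal, diagonal_mul,
    partialPinch, Matrix.of_apply, Complex.real_smul]
  by_cases hij : i = j
  · subst hij
    by_cases hi : i = k
    · simp [hi]; ring
    · simp [hi]; ring
  · by_cases hi : i = k
    · have hj : j ≠ k := fun h => hij (hi.trans h.symm)
      subst hi
      simp [hij, hj]
      split_ifs <;> ring
    · by_cases hj : j = k
      · subst hj
        simp [hi]
        norm_num
      · by_cases h : i ∉ S ∧ j ∉ S
        · simp [hij, hi, hj, h]; ring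
        · have h' : ¬((¬i = k ∧ i ∉ S) ∧ ¬j = k ∧ j ∉ S) := fun h2 => h ⟨h2.1.2, h2.2.2⟩
          simp [hij, h, h']

lemma isUnit_signFlip (k : Fin n) : IsUnit (signFlip k) :=
  IsUnit.of_mul_eq_one _ (signFlip_mul_self k)

/-- A concave function invariant under sign flips increases when its argument is replaced by
its diagonal part. -/
lemma le_partialPinch {f : Matrix (Fin n) (Fin n) ℂ → ℝ}
    (hf : ∀ A B : Matrix (Fin n) (Fin n) ℂ, A.PosDef → B.PosDef →
      1 / 2 * f A + (1 - 1 / 2) * f B ≤ f ((1 / 2 : ℝ) • A + (1 - 1 / 2 : ℝ) • B))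
    (hinv : ∀ (A : Matrix (Fin n) (Fin n) ℂ) (k : Fin n), A.PosDef →
      f ((signFlip k)ᴴ * A * signFlip k) = f A)
    {C : Matrix (Fin n) (Fin n) ℂ} (hC : C.PosDef) (S : Finset (Fin n)) :
    (partialPinch S C).PosDef ∧ f C ≤ f (partialPinch S C) := by
  induction S using Finset.induction_on with
  | empty =>
    have : partialPinch ∅ C = C := by ext i j; simp [partialPinch]
    rw [this]
    exact ⟨hC, le_rfl⟩
  | insert k S hk ih =>
    have hflip := posDef_conj (isUnit_signFlip k) ih.1
    rw [partialPinch_insert]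
    refine ⟨posDef_combination ih.1 hflip (by norm_num) (by norm_num), ih.2.trans ?_⟩
    have := hf _ _ ih.1 hflip
    rw [hinv _ k ih.1] at this
    linarith

lemma mpow_diagonal (d : Fin n → ℝ) (r : ℝ) :
    mpow (diagonal fun i => (d i : ℂ)) r = diagonal fun i => ((d i ^ r : ℝ) : ℂ) := by
  have h (e : Fin n → ℝ) : specMat 1 e = diagonal fun i => (e i : ℂ) := by simp [specMat]
  rw [← h, mpow_specMat (by simp), h]

lemma reTr_diagonal_mul (d : Fin n → ℝ) (C : Matrix (Fin n) (Fin n) ℂ) :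
    reTr ((diagonal fun i => (d i : ℂ)) * C) = ∑ i, d i * (C i i).re := by
  simp [reTr, trace, diagonal_mul]

/-- The Araki–Lieb–Thirring inequality when one of the matrices is diagonal. -/
lemma araki_lieb_thirring_diagonal {d : Fin n → ℝ} (hd : ∀ i, 0 < d i)
    {C : Matrix (Fin n) (Fin n) ℂ} (hC : C.PosDef) {s : ℝ} (hs : 1 ≤ s) :
    reTr (mpow ((diagonal fun i => ((d i ^ (1 / 2 : ℝ) : ℝ) : ℂ)) * mpow C (1 / s) *
      diagonal fun i => ((d i ^ (1 / 2 : ℝ) : ℝ) : ℂ)) s) ≤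
      reTr ((diagonal fun i => ((d i ^ s : ℝ) : ℂ)) * C) := by
  have hs0 : 0 < s := by linarith
  set K : Matrix (Fin n) (Fin n) ℂ := diagonal fun i => ((d i ^ (1 / 2 : ℝ) : ℝ) : ℂ) with hKdef
  have hKpos : K.PosDef := posDef_diagonal_ofReal fun i => Real.rpow_pos_of_pos (hd i) _
  have hKH : Kᴴ = K := hKpos.1
  have hK : IsUnit K := hKpos.isUnit
  have hRK (k : Fin n) : signFlip k * K = K * signFlip k := by
    rw [hKdef, signFlip, diagonal_mul_diagonal, diagonal_mul_diagonal]
    congr 1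
    ext i
    exact mul_comm _ _
  have hpinch := le_partialPinch (f := fun C => reTr (mpow (Kᴴ * mpow C (1 / s) * K) s))
    (fun A B hA hB => epstein_concave (by positivity) ((div_le_one hs0).2 hs) hs0
      (by rw [mul_one_div_cancel hs0.ne']) hK hA hB (by norm_num) (by norm_num))
    (fun A k hA => by
      have hR := signFlip_conjTranspose k
      have hRR := signFlip_mul_self k
      have hu : (signFlip k)ᴴ * signFlip k = 1 := by rw [hR, hRR]
      have h1 : mpow ((signFlip k)ᴴ * A * signFlip k) (1 / s) =
          signFlip k * mpow A (1 / s) * (signFlip k)ᴴ := by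
        rw [← mpow_unitary_conj hA hu, hR]
      have h2 : Kᴴ * (signFlip k * mpow A (1 / s) * (signFlip k)ᴴ) * K =
          signFlip k * (Kᴴ * mpow A (1 / s) * K) * (signFlip k)ᴴ := by
        rw [hR, hKH]
        simp only [Matrix.mul_assoc, hRK]
        simp only [← Matrix.mul_assoc, hRK]
      rw [h1, h2, mpow_unitary_conj (posDef_conj hK (posDef_mpow hA _)) hu, reTr_mul_comm,
        ← Matrix.mul_assoc, hu, Matrix.one_mul]) hC Finset.univ
  have hdiag : partialPinch Finset.univ C = diagonal fun i => (((C i i).re : ℝ) : ℂ) := by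
    ext i j
    by_cases hij : i = j
    · subst hij
      have := hC.1.coe_re_apply_self i
      simpa [partialPinch] using this.symm
    · simp [partialPinch, hij]
  have hCpos (i : Fin n) : 0 < (C i i).re := (Complex.pos_iff.1 hC.diag_pos).1
  have h := hpinch.2
  rw [hdiag, hKH, mpow_diagonal, hKdef, diagonal_mul_diagonal, diagonal_mul_diagonal] at h
  refine h.trans (le_of_eq ?_)
  rw [reTr_diagonal_mul]
  have : (fun i => ((d i ^ (1 / 2 : ℝ) : ℝ) : ℂ) * (((C i i).re ^ (1 / s) : ℝ) : ℂ) *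
      ((d i ^ (1 / 2 : ℝ) : ℝ) : ℂ)) = fun i => ((d i * (C i i).re ^ (1 / s) : ℝ) : ℂ) := by
    ext i
    have : d i ^ (1 / 2 : ℝ) * d i ^ (1 / 2 : ℝ) = d i := by
      rw [← Real.rpow_add (hd i)]
      norm_num
    norm_cast
    rw [mul_right_comm, this]
  rw [this, mpow_diagonal, reTr, trace_diagonal, Complex.re_sum]
  refine Finset.sum_congr rfl fun i _ => ?_
  rw [Complex.ofReal_re, Real.mul_rpow (hd i).le (Real.rpow_nonneg (hCpos i).le _),
    ← Real.rpow_mul (hCpos i).le, one_div_mul_cancel hs0.ne', Real.rpow_one]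

/-- The Araki–Lieb–Thirring inequality. -/
lemma araki_lieb_thirring {P Q : Matrix (Fin n) (Fin n) ℂ} (hP : P.PosDef) (hQ : Q.PosDef)
    {s : ℝ} (hs : 1 ≤ s) :
    reTr (mpow (mpow Q (1 / 2) * P * mpow Q (1 / 2)) s) ≤ reTr (mpow P s * mpow Q s) := by
  have hs0 : 0 < s := by linarith
  obtain ⟨U, d, hU, hd, rfl⟩ := exists_specMat hQ
  have hU' := mul_eq_one_comm.1 hU
  have hUH : Uᴴᴴ * Uᴴ = 1 := by rw [conjTranspose_conjTranspose, hU']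
  have hC : (Uᴴ * mpow P s * U).PosDef :=
    posDef_conj (IsUnit.of_mul_eq_one _ hU') (posDef_mpow hP s)
  have h := araki_lieb_thirring_diagonal hd hC hs
  have h1 : mpow (Uᴴ * mpow P s * U) (1 / s) = Uᴴ * P * U := by
    have := mpow_unitary_conj (posDef_mpow hP s) hUH (1 / s)
    rw [conjTranspose_conjTranspose, mpow_mpow hP, mul_one_div_cancel hs0.ne', mpow_one hP] at this
    exact this
  rw [h1] at h
  set K : Matrix (Fin n) (Fin n) ℂ := diagonal fun i => ((d i ^ (1 / 2 : ℝ) : ℝ) : ℂ) with hKdef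
  have hKpos : K.PosDef := posDef_diagonal_ofReal fun i => Real.rpow_pos_of_pos (hd i) _
  have hKH : Kᴴ = K := hKpos.1
  have hK : IsUnit K := hKpos.isUnit
  have hY : (K * (Uᴴ * P * U) * K).PosDef := by
    have := posDef_conj hK (posDef_conj (IsUnit.of_mul_eq_one _ hU') hP)
    rwa [hKH] at this
  rw [mpow_specMat hU, mpow_specMat hU]
  have h2 : specMat U (fun i => d i ^ (1 / 2 : ℝ)) * P * specMat U (fun i => d i ^ (1 / 2 : ℝ)) =
      U * (K * (Uᴴ * P * U) * K) * Uᴴ := by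
    simp only [specMat, Matrix.mul_assoc, hKdef]
  rw [h2, mpow_unitary_conj hY hU, reTr_mul_comm, ← Matrix.mul_assoc, hU, Matrix.one_mul]
  refine h.trans (le_of_eq ?_)
  rw [reTr_mul_comm, specMat, Matrix.mul_assoc, Matrix.mul_assoc, reTr_mul_comm,
    reTr_mul_comm (mpow P s)]
  simp only [Matrix.mul_assoc]
  rw [reTr_mul_comm]
  simp only [Matrix.mul_assoc]

/-- A Young type inequality for traces of powers of a product of two positive matrices. -/
lemma reTr_mpow_product_le {P Q : Matrix (Fin n) (Fin n) ℂ} (hP : P.PosDef) (hQ : Q.PosDef)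
    {α β s : ℝ} (hα : 0 < α) (hα1 : α ≤ 1) (hβ : 0 < β) (hs : 0 < s) (hsum : s * (α + β) = 1) :
    reTr (mpow (mpow Q (1 / 2) * P * mpow Q (1 / 2)) s) ≤
      s * α * reTr (mpow P (1 / α)) + s * β * reTr (mpow Q (1 / β)) := by
  rcases le_or_gt s 1 with hs1 | hs1
  · set X := mpow Q (1 / 2) * P * mpow Q (1 / 2) with hXdef
    have hX : X.PosDef := by
      have := posDef_conj (posDef_mpow hQ (1 / 2)).isUnit hP
      rwa [mpow_conjTranspose] at this
    have hs1' := sub_nonneg.2 hs1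
    have hα1' := sub_nonneg.2 hα1
    set θ := (1 - s) / (s * β) with hθ
    have hθ' : 1 - θ = (1 - α) / β := by
      rw [hθ]
      field_simp
      linarith
    have h1 := reTr_mpow_klein hX hQ (c₁ := -1) (c₂ := 1 - s) (c₃ := s) (a := s) (b := 1 / β)
      (a' := 1) (b' := -θ) fun x w hx hw => by
        have h := Real.geom_mean_le_arith_mean2_weighted hs.le hs1'
          (p₁ := x * w ^ (-θ)) (p₂ := w ^ (1 / β)) (by positivity) (by positivity) (by ring)
        have h2 : (x * w ^ (-θ)) ^ s * (w ^ (1 / β)) ^ (1 - s) = x ^ s := by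
          rw [Real.mul_rpow hx.le (by positivity), ← Real.rpow_mul hw.le, ← Real.rpow_mul hw.le,
            mul_assoc, ← Real.rpow_add hw]
          have : -θ * s + 1 / β * (1 - s) = 0 := by rw [hθ]; field_simp; ring
          rw [this, Real.rpow_zero, mul_one]
        rw [h2] at h
        rw [Real.rpow_one]
        linarith
    have h2 := reTr_mpow_klein hP hQ (c₁ := α) (c₂ := 1 - α) (c₃ := -1) (a := 1 / α)
      (b := 1 / β) (a' := 1) (b' := 1 - θ) fun x w hx hw => by
        have h := Real.geom_mean_le_arith_mean2_weighted hα.le hα1'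
          (p₁ := x ^ (1 / α)) (p₂ := w ^ (1 / β)) (by positivity) (by positivity) (by ring)
        rw [← Real.rpow_mul hx.le, ← Real.rpow_mul hw.le, one_div_mul_cancel hα.ne'] at h
        have : 1 / β * (1 - α) = 1 - θ := by rw [hθ']; ring
        rw [this] at h
        linarith
    rw [mpow_one hX] at h1
    rw [mpow_one hP] at h2
    have h3 : reTr (X * mpow Q (-θ)) = reTr (P * mpow Q (1 - θ)) := by
      rw [hXdef, Matrix.mul_assoc, Matrix.mul_assoc, reTr_mul_comm, Matrix.mul_assoc,
        Matrix.mul_assoc, mpow_mul_mpow hQ, mpow_mul_mpow hQ]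
      congr 3
      ring
    rw [h3] at h1
    have h4 := mul_nonneg hs.le h2
    have h5 : s * β = 1 - s * α := by linarith
    rw [h5]
    linarith
  · refine (araki_lieb_thirring hP hQ hs1.le).trans ?_
    have h := reTr_mpow_klein hP hQ (c₁ := s * α) (c₂ := s * β) (c₃ := -1) (a := 1 / α)
      (b := 1 / β) (a' := s) (b' := s) fun x w hx hw => by
        have h := Real.geom_mean_le_arith_mean2_weighted (mul_pos hs hα).le (mul_pos hs hβ).le
          (p₁ := x ^ (1 / α)) (p₂ := w ^ (1 / β)) (by positivity) (by positivity) (by linarith)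
        rw [← Real.rpow_mul hx.le, ← Real.rpow_mul hw.le] at h
        have h1 : 1 / α * (s * α) = s := by field_simp
        have h2 : 1 / β * (s * β) = s := by field_simp
        rw [h1, h2] at h
        linarith
    linarith

end Young

section Sufficiency

variable {n : ℕ}

lemma mpow_half_mul_mpow_half {A : Matrix (Fin n) (Fin n) ℂ} (hA : A.PosDef) (q : ℝ) :
    mpow A (q / 2) * mpow A (q / 2) = mpow A q := by
  rw [mpow_mul_mpow hA, add_halves]

lemma posDef_mpow_conj {A B : Matrix (Fin n) (Fin n) ℂ} (hA : A.PosDef) (hB : B.PosDef) (r : ℝ) :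
    (mpow A r * B * mpow A r).PosDef := by
  have := posDef_conj (posDef_mpow hA r).isUnit hB
  rwa [mpow_conjTranspose] at this

lemma reTr_mpow_half_conj_comm {P Q : Matrix (Fin n) (Fin n) ℂ} (hP : P.PosDef) (hQ : Q.PosDef)
    (p q s : ℝ) :
    reTr (mpow (mpow Q (q / 2) * mpow P p * mpow Q (q / 2)) s) =
      reTr (mpow (mpow P (p / 2) * mpow Q q * mpow P (p / 2)) s) := by
  have h1 : (mpow P (p / 2) * mpow Q (q / 2))ᴴ * (mpow P (p / 2) * mpow Q (q / 2)) =
      mpow Q (q / 2) * mpow P p * mpow Q (q / 2) := by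
    rw [← mpow_half_mul_mpow_half hP p]
    simp only [conjTranspose_mul, mpow_conjTranspose, Matrix.mul_assoc]
  have h2 : (mpow P (p / 2) * mpow Q (q / 2)) * (mpow P (p / 2) * mpow Q (q / 2))ᴴ =
      mpow P (p / 2) * mpow Q q * mpow P (p / 2) := by
    rw [← mpow_half_mul_mpow_half hQ q]
    simp only [conjTranspose_mul, mpow_conjTranspose, Matrix.mul_assoc]
  rw [← h1, ← h2]
  apply reTr_mpow_conjTranspose_mul
  rw [h1]
  exact posDef_mpow_conj hQ (posDef_mpow hP p) _

lemma Phi_comm {A B : Matrix (Fin n) (Fin n) ℂ} (hA : A.PosDef) (hB : B.PosDef) (p q s : ℝ) :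
    Phi p q s A B = Phi q p s B A :=
  reTr_mpow_half_conj_comm hB hA p q s

lemma Phi_le_add {A B Z K : Matrix (Fin n) (Fin n) ℂ} (hA : A.PosDef) (hB : B.PosDef)
    (hZK : Z * Kᴴ = 1) (p q : ℝ) {α β s : ℝ} (hα : 0 < α) (hα1 : α ≤ 1) (hβ : 0 < β) (hs : 0 < s)
    (hsum : s * (α + β) = 1) :
    Phi p q s A B ≤ s * α * reTr (mpow (Zᴴ * mpow B p * Z) (1 / α)) +
      s * β * reTr (mpow (Kᴴ * mpow A q * K) (1 / β)) := by
  have hKZ : K * Zᴴ = 1 := by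
    simpa using congrArg conjTranspose hZK
  have hKU : IsUnit K := IsUnit.of_mul_eq_one _ hKZ
  have hZU : IsUnit Z := IsUnit.of_mul_eq_one _ hZK
  set P := Zᴴ * mpow B p * Z with hPdef
  set Q := Kᴴ * mpow A q * K with hQdef
  have hP : P.PosDef := posDef_conj hZU (posDef_mpow hB p)
  have hQ : Q.PosDef := posDef_conj hKU (posDef_mpow hA q)
  refine le_trans (le_of_eq ?_) (reTr_mpow_product_le hP hQ hα hα1 hβ hs hsum)
  have hcomm := reTr_mpow_half_conj_comm hP hQ 1 1 s
  rw [mpow_one hP, mpow_one hQ] at hcomm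
  rw [hcomm]
  have hPB : K * P * Kᴴ = mpow B p := by
    calc K * P * Kᴴ = (K * Zᴴ) * mpow B p * (Z * Kᴴ) := by
          simp only [hPdef, Matrix.mul_assoc]
      _ = mpow B p := by rw [hZK, hKZ, Matrix.one_mul, Matrix.mul_one]
  have hPP : mpow P (1 / 2) * mpow P (1 / 2) = P := by
    rw [mpow_half_mul_mpow_half hP, mpow_one hP]
  set S := mpow P (1 / 2) * Kᴴ * mpow A (q / 2) with hS
  have h1 : Sᴴ * S = mpow A (q / 2) * mpow B p * mpow A (q / 2) := by
    calc Sᴴ * S = mpow A (q / 2) * (K * (mpow P (1 / 2) * mpow P (1 / 2)) * Kᴴ) *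
          mpow A (q / 2) := by
          simp only [hS, conjTranspose_mul, conjTranspose_conjTranspose, mpow_conjTranspose,
            Matrix.mul_assoc]
      _ = _ := by rw [hPP, hPB]
  have h2 : S * Sᴴ = mpow P (1 / 2) * Q * mpow P (1 / 2) := by
    rw [hQdef, ← mpow_half_mul_mpow_half hA q]
    simp only [hS, conjTranspose_mul, conjTranspose_conjTranspose, mpow_conjTranspose,
      Matrix.mul_assoc]
  rw [← h2, ← reTr_mpow_conjTranspose_mul, h1]
  · rfl
  · rw [h1]
    exact posDef_mpow_conj hA (posDef_mpow hB p) _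

lemma exists_Phi_eq_add {A B : Matrix (Fin n) (Fin n) ℂ} (hA : A.PosDef) (hB : B.PosDef)
    (p q : ℝ) {α β s : ℝ} (hα : 0 < α) (hβ : 0 < β) (hsum : s * (α + β) = 1) :
    ∃ Z K : Matrix (Fin n) (Fin n) ℂ, Z * Kᴴ = 1 ∧
      Phi p q s A B = s * α * reTr (mpow (Zᴴ * mpow B p * Z) (1 / α)) +
        s * β * reTr (mpow (Kᴴ * mpow A q * K) (1 / β)) := by
  set X := mpow A (q / 2) * mpow B p * mpow A (q / 2) with hXdef
  have hX : X.PosDef := posDef_mpow_conj hA (posDef_mpow hB p) _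
  have hAA : mpow A (q / 2) * mpow A (-(q / 2)) = 1 := by
    rw [mpow_mul_mpow hA, add_neg_cancel, mpow_zero hA]
  have hAqA : mpow A (-(q / 2)) * mpow A q * mpow A (-(q / 2)) = 1 := by
    rw [mpow_mul_mpow hA, mpow_mul_mpow hA, ← mpow_zero hA]
    congr 1
    ring
  refine ⟨mpow A (q / 2) * mpow X (-(β * s / 2)), mpow A (-(q / 2)) * mpow X (β * s / 2), ?_, ?_⟩
  · have hXX : mpow X (-(β * s / 2)) * mpow X (β * s / 2) = 1 := by
      rw [mpow_mul_mpow hX, neg_add_cancel, mpow_zero hX]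
    rw [conjTranspose_mul, mpow_conjTranspose, mpow_conjTranspose, Matrix.mul_assoc,
      ← Matrix.mul_assoc (mpow X _), hXX, Matrix.one_mul, hAA]
  · have hZ : (mpow A (q / 2) * mpow X (-(β * s / 2)))ᴴ * mpow B p *
        (mpow A (q / 2) * mpow X (-(β * s / 2))) = mpow X (α * s) := by
      calc _ = mpow X (-(β * s / 2)) * X * mpow X (-(β * s / 2)) := by
            simp only [hXdef, conjTranspose_mul, mpow_conjTranspose, Matrix.mul_assoc]
        _ = mpow X (-(β * s / 2)) * mpow X 1 * mpow X (-(β * s / 2)) := by rw [mpow_one hX]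
        _ = mpow X (α * s) := by
            rw [mpow_mul_mpow hX, mpow_mul_mpow hX]
            congr 1
            linarith
    have hK : (mpow A (-(q / 2)) * mpow X (β * s / 2))ᴴ * mpow A q *
        (mpow A (-(q / 2)) * mpow X (β * s / 2)) = mpow X (β * s) := by
      calc _ = mpow X (β * s / 2) * (mpow A (-(q / 2)) * mpow A q * mpow A (-(q / 2))) *
            mpow X (β * s / 2) := by
            simp only [conjTranspose_mul, mpow_conjTranspose, Matrix.mul_assoc]
        _ = mpow X (β * s) := by rw [hAqA, Matrix.mul_one, mpow_half_mul_mpow_half hX]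
    rw [hZ, hK, mpow_mpow hX, mpow_mpow hX]
    have hα' : α * s * (1 / α) = s := by field_simp
    have hβ' : β * s * (1 / β) = s := by field_simp
    rw [hα', hβ', ← add_mul, ← mul_add, hsum, one_mul]
    rfl

theorem jointlyConcave_Phi {p q s : ℝ} (hp : 0 < p) (hp1 : p ≤ 1) (hq : 0 < q) (hq1 : q ≤ 1)
    (hs : 0 < s) (hspq : s ≤ 1 / (p + q)) : JointlyConcave (Phi (n := n) p q s) := by
  intro A₁ A₂ B₁ B₂ hA₁ hA₂ hB₁ hB₂ t ht0 ht1
  have hpq : p + q ≤ 1 / s := by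
    rw [le_div_iff₀ hs, mul_comm]
    exact (le_div_iff₀ (by positivity)).1 hspq
  obtain ⟨α, β, hpα, hα1, hqβ, hsum'⟩ : ∃ α β : ℝ, p ≤ α ∧ α ≤ 1 ∧ q ≤ β ∧ α + β = 1 / s := by
    refine ⟨min 1 (1 / s - q), 1 / s - min 1 (1 / s - q), ?_, min_le_left _ _, ?_, by ring⟩
    · exact le_min hp1 (by linarith)
    · linarith [min_le_right 1 (1 / s - q)]
  have hsum : s * (α + β) = 1 := by rw [hsum', mul_one_div_cancel hs.ne']
  have hα : 0 < α := hp.trans_le hpα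
  have hβ : 0 < β := hq.trans_le hqβ
  obtain ⟨Z, K, hZK, hPhi⟩ := exists_Phi_eq_add (posDef_combination hA₁ hA₂ ht0 ht1)
    (posDef_combination hB₁ hB₂ ht0 ht1) p q hα hβ hsum
  have hZU : IsUnit Z := IsUnit.of_mul_eq_one _ hZK
  have hKU : IsUnit K := IsUnit.of_mul_eq_one Zᴴ (by simpa using congrArg conjTranspose hZK)
  have h1 := Phi_le_add hA₁ hB₁ hZK p q hα hα1 hβ hs hsum
  have h2 := Phi_le_add hA₂ hB₂ hZK p q hα hα1 hβ hs hsum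
  have hB := epstein_concave hp hp1 (one_div_pos.2 hα)
    (by rw [one_div_mul_eq_div]; exact (div_le_one hα).2 hpα) hZU hB₁ hB₂ ht0 ht1
  have hA := epstein_concave hq hq1 (one_div_pos.2 hβ)
    (by rw [one_div_mul_eq_div]; exact (div_le_one hβ).2 hqβ) hKU hA₁ hA₂ ht0 ht1
  rw [hPhi]
  have h1' := mul_le_mul_of_nonneg_left h1 ht0
  have h2' := mul_le_mul_of_nonneg_left h2 (sub_nonneg.2 ht1)
  have hA' := mul_le_mul_of_nonneg_left hA (mul_pos hs hβ).le
  have hB' := mul_le_mul_of_nonneg_left hB (mul_pos hs hα).le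
  linarith

end Sufficiency

section Necessity

variable {n : ℕ}

lemma rpow_exponent_mem_Ioc {z : ℝ} (hz : z ≠ 0)
    (h : ∀ b : ℝ, 0 < b → (1 + b ^ z) / 2 ≤ ((1 + b) / 2) ^ z) : 0 < z ∧ z ≤ 1 := by
  by_contra hcon
  have hz1 : 0 < 1 - 1 / z := by
    rcases lt_or_gt_of_ne hz with hneg | hpos
    · have := one_div_neg.2 hneg
      linarith
    · have hlt : 1 < z := by
        by_contra hle
        exact hcon ⟨hpos, not_lt.1 hle⟩
      have := (div_lt_one hpos).2 hlt
      linarith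
  have hb : 0 < (2 : ℝ) ^ (1 - 1 / z) - 1 :=
    sub_pos.2 (Real.one_lt_rpow (by norm_num) hz1)
  have h1 := h _ hb
  have h2 : ((1 + ((2 : ℝ) ^ (1 - 1 / z) - 1)) / 2) ^ z = 1 / 2 := by
    rw [add_sub_cancel, Real.rpow_sub two_pos, Real.rpow_one, div_div_cancel_left' two_ne_zero,
      ← Real.rpow_neg two_pos.le, ← Real.rpow_mul two_pos.le, neg_mul, one_div_mul_cancel hz,
      Real.rpow_neg_one, one_div]
  rw [h2] at h1
  have := Real.rpow_pos_of_pos hb z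
  linarith

lemma reTr_diagonal (d : Fin n → ℝ) : reTr (diagonal fun i => (d i : ℂ)) = ∑ i, d i := by
  simp [reTr, trace_diagonal]

lemma Phi_diagonal {a b : Fin n → ℝ} (ha : ∀ i, 0 < a i) (hb : ∀ i, 0 < b i) (p q s : ℝ) :
    Phi p q s (diagonal fun i => (a i : ℂ)) (diagonal fun i => (b i : ℂ)) =
      ∑ i, a i ^ (q * s) * b i ^ (p * s) := by
  change reTr (mpow (mpow _ (q / 2) * mpow _ p * mpow _ (q / 2)) s) = _
  rw [mpow_diagonal, mpow_diagonal, diagonal_mul_diagonal, diagonal_mul_diagonal]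
  have h : (fun i => ((a i ^ (q / 2) : ℝ) : ℂ) * ((b i ^ p : ℝ) : ℂ) * ((a i ^ (q / 2) : ℝ) : ℂ)) =
      fun i => ((a i ^ q * b i ^ p : ℝ) : ℂ) := by
    ext i
    rw [← add_halves q, Real.rpow_add (ha i), add_halves]
    push_cast
    ring
  rw [h, mpow_diagonal, reTr_diagonal]
  refine Finset.sum_congr rfl fun i _ => ?_
  rw [Real.mul_rpow (Real.rpow_nonneg (ha i).le _) (Real.rpow_nonneg (hb i).le _),
    ← Real.rpow_mul (ha i).le, ← Real.rpow_mul (hb i).le]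

lemma half_smul_diagonal_add (a b : Fin n → ℝ) :
    (1 / 2 : ℝ) • (diagonal fun i => (a i : ℂ)) + (1 - 1 / 2 : ℝ) • (diagonal fun i => (b i : ℂ)) =
      diagonal fun i => (((a i + b i) / 2 : ℝ) : ℂ) := by
  rw [← diagonal_smul, ← diagonal_smul, diagonal_add]
  congr 1
  ext i
  simp only [Pi.smul_apply, Complex.real_smul]
  push_cast
  ring

lemma scalar_concave {p q s : ℝ} (h : JointlyConcave (Phi (n := 1) p q s)) {a b : ℝ}
    (ha : 0 < a) (hb : 0 < b) :
    (1 + a ^ (q * s) * b ^ (p * s)) / 2 ≤ ((1 + a) / 2) ^ (q * s) * ((1 + b) / 2) ^ (p * s) := by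
  have h1 (i : Fin 1) : (0 : ℝ) < (fun _ => 1 : Fin 1 → ℝ) i := one_pos
  have ha' (i : Fin 1) : (0 : ℝ) < (fun _ => a : Fin 1 → ℝ) i := ha
  have hb' (i : Fin 1) : (0 : ℝ) < (fun _ => b : Fin 1 → ℝ) i := hb
  have h2 := h _ _ _ _ (posDef_diagonal_ofReal h1) (posDef_diagonal_ofReal ha')
    (posDef_diagonal_ofReal h1) (posDef_diagonal_ofReal hb') (1 / 2) (by norm_num) (by norm_num)
  rw [half_smul_diagonal_add, half_smul_diagonal_add, Phi_diagonal h1 h1, Phi_diagonal ha' hb',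
    Phi_diagonal (fun _ => by positivity) (fun _ => by positivity)] at h2
  simp only [Finset.univ_unique, Finset.sum_singleton, Real.one_rpow] at h2
  linarith

lemma specMat_apply_diag (U : Matrix (Fin n) (Fin n) ℂ) (d : Fin n → ℝ) (i : Fin n) :
    (specMat U d i i).re = ∑ j, Complex.normSq (U i j) * d j := by
  rw [specMat, mul_apply, Complex.re_sum]
  refine Finset.sum_congr rfl fun j _ => ?_
  rw [mul_diagonal, conjTranspose_apply, Complex.star_def]
  have : U i j * (d j : ℂ) * (starRingEnd ℂ) (U i j) =
      ((Complex.normSq (U i j) * d j : ℝ) : ℂ) := by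
    push_cast
    rw [← Complex.mul_conj]
    ring
  rw [this, Complex.ofReal_re]

lemma rpow_diag_le_reTr {X : Matrix (Fin n) (Fin n) ℂ} (hX : X.PosDef) {s : ℝ} (hs : 0 ≤ s)
    (i : Fin n) : (X i i).re ^ s ≤ reTr (mpow X s) := by
  have hpos : 0 < (X i i).re := (Complex.pos_iff.1 hX.diag_pos).1
  obtain ⟨U, d, hU, hd, rfl⟩ := exists_specMat hX
  obtain ⟨k, -, hk⟩ := Finset.exists_max_image Finset.univ d ⟨i, Finset.mem_univ i⟩
  have hle : (specMat U d i i).re ≤ d k := by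
    rw [specMat_apply_diag]
    calc ∑ j, Complex.normSq (U i j) * d j ≤ ∑ j, Complex.normSq (U i j) * d k :=
          Finset.sum_le_sum fun j hj =>
            mul_le_mul_of_nonneg_left (hk j hj) (Complex.normSq_nonneg _)
      _ = d k := by
          rw [← Finset.sum_mul, sum_normSq_mul_left (mul_eq_one_comm.1 hU), one_mul]
  rw [mpow_specMat hU, reTr_specMat hU]
  calc (specMat U d i i).re ^ s ≤ d k ^ s := Real.rpow_le_rpow hpos.le hle hs
    _ ≤ ∑ j, d j ^ s :=
      Finset.single_le_sum (f := fun j => d j ^ s)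
        (fun j _ => Real.rpow_nonneg (hd j).le _) (Finset.mem_univ k)

/-- The normalized `2 × 2` Hadamard matrix. -/
noncomputable def hadamardTwo : Matrix (Fin 2) (Fin 2) ℂ :=
  ((Real.sqrt (1 / 2) : ℝ) : ℂ) • !![1, 1; 1, -1]

lemma sqrt_half_mul_self :
    ((Real.sqrt (1 / 2) : ℝ) : ℂ) * ((Real.sqrt (1 / 2) : ℝ) : ℂ) = 1 / 2 := by
  rw [← Complex.ofReal_mul, Real.mul_self_sqrt (by norm_num)]
  norm_num

lemma hadamardTwo_conjTranspose_mul : hadamardTwoᴴ * hadamardTwo = 1 := by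
  rw [hadamardTwo, conjTranspose_smul, smul_mul_smul_comm, Complex.star_def, Complex.conj_ofReal,
    sqrt_half_mul_self]
  ext i j
  fin_cases i <;> fin_cases j <;> simp [mul_apply, Fin.sum_univ_two] <;> norm_num

lemma normSq_hadamardTwo (i j : Fin 2) : Complex.normSq (hadamardTwo i j) = 1 / 2 := by
  rw [hadamardTwo, Matrix.smul_apply, smul_eq_mul, Complex.normSq_mul, Complex.normSq_ofReal,
    Real.mul_self_sqrt (by norm_num)]
  fin_cases i <;> fin_cases j <;> simp

lemma specMat_const {U : Matrix (Fin n) (Fin n) ℂ} (hU : Uᴴ * U = 1) (c : ℝ) :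
    specMat U (fun _ => c) = diagonal fun _ => (c : ℂ) := by
  rw [specMat, ← smul_one_eq_diagonal, Matrix.mul_smul, Matrix.mul_one, Matrix.smul_mul,
    mul_eq_one_comm.1 hU]

lemma half_smul_specMat_add (U : Matrix (Fin n) (Fin n) ℂ) (a b : Fin n → ℝ) :
    (1 / 2 : ℝ) • specMat U a + (1 - 1 / 2 : ℝ) • specMat U b =
      specMat U fun i => (a i + b i) / 2 := by
  have := half_smul_diagonal_add a b
  simp only [specMat, ← this, Matrix.mul_add, Matrix.add_mul, Matrix.mul_smul, Matrix.smul_mul]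

lemma le_Phi_hadamardTwo {a b : Fin 2 → ℝ} (ha : ∀ i, 0 < a i) (hb : ∀ i, 0 < b i)
    (ha0 : a 0 = 1) (p q : ℝ) {s : ℝ} (hs : 0 ≤ s) :
    ((b 0 ^ p + b 1 ^ p) / 2) ^ s ≤
      Phi p q s (diagonal fun i => (a i : ℂ)) (specMat hadamardTwo b) := by
  have hU := hadamardTwo_conjTranspose_mul
  have h := rpow_diag_le_reTr (posDef_mpow_conj (posDef_diagonal_ofReal ha)
    (posDef_mpow (posDef_specMat hU hb) p) (q / 2)) hs 0
  refine le_trans (le_of_eq ?_) h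
  rw [mpow_diagonal, mpow_specMat hU, mul_diagonal, diagonal_mul, ha0, Real.one_rpow,
    Complex.ofReal_one, one_mul, mul_one, specMat_apply_diag]
  simp only [normSq_hadamardTwo, Fin.sum_univ_two]
  congr 1
  ring

lemma exponent_le_one {p q s : ℝ} (hp : 0 < p) (hq : 0 < q) (hs : 0 < s)
    (h : JointlyConcave (Phi (n := 2) p q s)) : p ≤ 1 := by
  have hU := hadamardTwo_conjTranspose_mul
  have key (x : ℝ) (hx : 0 < x) :
      (1 / 2 : ℝ) ^ s ≤ (1 + x ^ (q * s)) * (1 / 2 + x) ^ (p * s) := by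
    have ha (i : Fin 2) : 0 < ![1, x] i := by fin_cases i <;> simp [hx]
    have hb₁ (i : Fin 2) : 0 < ![1 + x, x] i := by fin_cases i <;> simp <;> positivity
    have hb₂ (i : Fin 2) : 0 < ![x, 1 + x] i := by fin_cases i <;> simp <;> positivity
    have hA := posDef_diagonal_ofReal ha
    have h1 := h _ _ _ _ hA hA (posDef_specMat hU hb₁) (posDef_specMat hU hb₂) (1 / 2)
      (by norm_num) (by norm_num)
    have hmid : (fun i => (![1 + x, x] i + ![x, 1 + x] i) / 2) = fun _ : Fin 2 => 1 / 2 + x := by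
      ext i
      fin_cases i <;> simp <;> ring
    rw [← add_smul, add_sub_cancel, one_smul, half_smul_specMat_add, hmid, specMat_const hU,
      Phi_diagonal ha (fun _ => by positivity)] at h1
    have hlow : (1 / 2 : ℝ) ^ s ≤ (((1 + x) ^ p + x ^ p) / 2) ^ s := by
      refine Real.rpow_le_rpow (by norm_num) ?_ hs.le
      have := Real.one_le_rpow (x := 1 + x) (by linarith) hp.le
      have := Real.rpow_pos_of_pos hx p
      linarith
    have h2 := le_Phi_hadamardTwo ha hb₁ rfl p q hs.le
    have h3 := le_Phi_hadamardTwo ha hb₂ rfl p q hs.le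
    simp only [cons_val_zero, cons_val_one, Fin.sum_univ_two, Real.one_rpow] at h1 h2 h3
    rw [add_comm (x ^ p)] at h3
    linarith
  have hcont : ContinuousAt (fun x : ℝ => (1 + x ^ (q * s)) * (1 / 2 + x) ^ (p * s)) 0 := by
    refine ContinuousAt.mul (continuousAt_const.add
      (Real.continuousAt_rpow_const _ _ (Or.inr (by positivity)))) ?_
    exact (continuousAt_const.add continuousAt_id).rpow_const (Or.inl (by norm_num))
  have hlim := ge_of_tendsto (hcont.tendsto.mono_left nhdsWithin_le_nhds)
    (Filter.eventually_of_mem (self_mem_nhdsWithin (s := Set.Ioi 0)) key)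
  rw [Real.zero_rpow (by positivity), add_zero, add_zero, one_mul] at hlim
  have := (Real.rpow_le_rpow_left_iff_of_base_lt_one (by norm_num) (by norm_num)).1 hlim
  exact (mul_le_iff_le_one_left hs).1 this

lemma jointlyConcave_Phi_swap {p q s : ℝ} (h : JointlyConcave (Phi (n := n) p q s)) :
    JointlyConcave (Phi (n := n) q p s) := by
  intro A₁ A₂ B₁ B₂ hA₁ hA₂ hB₁ hB₂ t h0 h1
  rw [Phi_comm hA₁ hB₁, Phi_comm hA₂ hB₂,
    Phi_comm (posDef_combination hA₁ hA₂ h0 h1) (posDef_combination hB₁ hB₂ h0 h1)]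
  exact h _ _ _ _ hB₁ hB₂ hA₁ hA₂ t h0 h1

lemma exponent_bounds {p q s : ℝ} (hp : p ≠ 0) (hq : q ≠ 0) (hs : 0 < s)
    (h : JointlyConcave (Phi (n := 1) p q s)) : 0 < p ∧ 0 < q ∧ s ≤ 1 / (p + q) := by
  have hp0 : 0 < p := by
    refine pos_of_mul_pos_left
      (rpow_exponent_mem_Ioc (mul_ne_zero hp hs.ne') fun b hb => ?_).1 hs.le
    simpa using scalar_concave h one_pos hb
  have hq0 : 0 < q := by
    refine pos_of_mul_pos_left
      (rpow_exponent_mem_Ioc (mul_ne_zero hq hs.ne') fun b hb => ?_).1 hs.le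
    simpa using scalar_concave h hb one_pos
  refine ⟨hp0, hq0, ?_⟩
  have hpq : 0 < q * s + p * s := by positivity
  rw [le_div_iff₀ (by positivity)]
  refine le_trans (le_of_eq (by ring)) (rpow_exponent_mem_Ioc hpq.ne' fun b hb => ?_).2
  rw [Real.rpow_add hb, Real.rpow_add (by positivity)]
  exact scalar_concave h hb hb

end Necessity

/-- Theorem 4.4: `Φ_{p,q,s}` is jointly concave for all `n` if and only if
`0 < p ≤ 1`, `0 < q ≤ 1` and `0 < s ≤ 1/(p+q)`. -/
theorem phi_jointly_concave_iff (p q s : ℝ) (hp : p ≠ 0) (hq : q ≠ 0) (hs : 0 < s) :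
    (∀ n : ℕ, JointlyConcave (Phi (n := n) p q s)) ↔
      (0 < p ∧ p ≤ 1 ∧ 0 < q ∧ q ≤ 1 ∧ 0 < s ∧ s ≤ 1 / (p + q)) := by
  constructor
  · intro h
    obtain ⟨hp0, hq0, hspq⟩ := exponent_bounds hp hq hs (h 1)
    exact ⟨hp0, exponent_le_one hp0 hq0 hs (h 2), hq0,
      exponent_le_one hq0 hp0 hs (jointlyConcave_Phi_swap (h 2)), hs, hspq⟩
  · rintro ⟨hp0, hp1, hq0, hq1, hs0, hspq⟩ n
    exact jointlyConcave_Phi hp0 hp1 hq0 hq1 hs0 hspq
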